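/- For every non-negative integer n, \(\sum_{k=0}^{n} \binom{2n}{n+k} L_{k}^{4} = 3^{2n} + 3 \cdot 2^{2n} + 8\binom{2n}{n} + 4(-1)^{n}\). -/

import Mathlib

/-- The Lucas numbers: `L 0 = 2`, `L 1 = 1`, `L (n+2) = L (n+1) + L n`. -/
def lucas : ℕ → ℕ
  | 0 => 2
  | 1 => 1
  | n + 2 => lucas (n + 1) + lucas n

open Real in
/-- Binet's formula for the Lucas numbers. -/
theorem coe_lucas_eq (n : ℕ) : (lucas n : ℝ) = goldenRatio ^ n + goldenConj ^ n := by
  induction n using lucas.induct with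
  | case1 => norm_num [lucas]
  | case2 => simp [lucas]
  | case3 n ih₁ ih₀ =>
    rw [lucas, Nat.cast_add, ih₁, ih₀, pow_add _ n 2, pow_add _ n 2, goldenRatio_sq, goldenConj_sq]
    ring

/-- Half of the symmetric binomial expansion of `(x + y + 2) ^ n = (x + 1) ^ (2 * n) * y ^ n`,
where `x * y = 1`. -/
theorem sum_choose_mul_pow_add_pow {R : Type*} [CommRing R] {x y : R} (h : x * y = 1) (n : ℕ) :
    ∑ k ∈ Finset.range (n + 1), ((2 * n).choose (n + k) : R) * (x ^ k + y ^ k) =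
      (x + y + 2) ^ n + (2 * n).choose n := by
  have hxy (k : ℕ) : x ^ k * y ^ k = 1 := by rw [← mul_pow, h, one_pow]
  have hpow : (x + y + 2) ^ n =
      ∑ m ∈ Finset.range (n + (n + 1)), ((2 * n).choose m : R) * (x ^ m * y ^ n) := by
    have hbase : x + y + 2 = (x + 1) ^ 2 * y := by linear_combination (-x - 2) * h
    rw [hbase, mul_pow, ← pow_mul, add_pow, Finset.sum_mul, ← add_assoc, ← two_mul]
    refine Finset.sum_congr rfl fun m _ => ?_
    rw [one_pow]
    ring
  have hupper : ∑ k ∈ Finset.range (n + 1), ((2 * n).choose (n + k) : R) * x ^ k =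
      ∑ k ∈ Finset.range (n + 1), ((2 * n).choose (n + k) : R) * (x ^ (n + k) * y ^ n) := by
    refine Finset.sum_congr rfl fun k _ => ?_
    rw [pow_add]
    linear_combination (-((2 * n).choose (n + k) : R) * x ^ k) * hxy n
  have hlower : ∑ k ∈ Finset.range (n + 1), ((2 * n).choose (n + k) : R) * y ^ k =
      ∑ m ∈ Finset.range (n + 1), ((2 * n).choose m : R) * (x ^ m * y ^ n) := by
    rw [← Finset.sum_range_reflect]
    refine Finset.sum_congr rfl fun m hm => ?_
    obtain ⟨j, rfl⟩ := Nat.exists_eq_add_of_le (Finset.mem_range_succ_iff.mp hm)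
    rw [show m + j + 1 - 1 - m = j by omega,
      Nat.choose_symm_of_eq_add (show 2 * (m + j) = (m + j + j) + m by ring), pow_add]
    linear_combination (-((2 * (m + j)).choose m : R) * y ^ j) * hxy m
  simp_rw [mul_add]
  rw [Finset.sum_add_distrib, hupper, hlower, hpow, Finset.sum_range_add _ n (n + 1),
    Finset.sum_range_succ (fun m => ((2 * n).choose m : R) * (x ^ m * y ^ n)) n]
  linear_combination ((2 * n).choose n : R) * hxy n

/-- For every non-negative integer `n`,
`∑_{k=0}^n C(2n, n+k) L_k⁴ = 3^{2n} + 3·2^{2n} + 8 C(2n,n) + 4(-1)^n` (as integers). -/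
theorem sum_choose_lucas_fourth (n : ℕ) :
    ∑ k ∈ Finset.range (n + 1),
        ((Nat.choose (2 * n) (n + k) : ℤ) * (lucas k : ℤ) ^ 4) =
      3 ^ (2 * n) + 3 * 2 ^ (2 * n) + 8 * (Nat.choose (2 * n) n : ℤ) + 4 * (-1) ^ n := by
  have key : ∑ k ∈ Finset.range (n + 1), ((Nat.choose (2 * n) (n + k) : ℝ) * (lucas k : ℝ) ^ 4) =
      3 ^ (2 * n) + 3 * 2 ^ (2 * n) + 8 * (Nat.choose (2 * n) n : ℝ) + 4 * (-1) ^ n := by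
    set a := Real.goldenRatio
    set b := Real.goldenConj
    have hab : a * b = -1 := Real.goldenRatio_mul_goldenConj
    have ha : a ^ 2 = a + 1 := Real.goldenRatio_sq
    have hb : b ^ 2 = b + 1 := Real.goldenConj_sq
    have hs : a + b = 1 := Real.goldenRatio_add_goldenConj
    have hL (k : ℕ) : (lucas k : ℝ) = a ^ k + b ^ k := coe_lucas_eq k
    clear_value a b
    have hs₂ : a ^ 2 + b ^ 2 = 3 := by linear_combination ha + hb + hs
    have hs₄ : a ^ 4 + b ^ 4 = 7 := by
      linear_combination (a ^ 2 + b ^ 2 + 3) * hs₂ - 2 * (a * b - 1) * hab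
    have h₄ := sum_choose_mul_pow_add_pow (x := a ^ 4) (y := b ^ 4)
      (by rw [← mul_pow, hab]; norm_num) n
    have h₂ := sum_choose_mul_pow_add_pow (x := -a ^ 2) (y := -b ^ 2)
      (by rw [neg_mul_neg, ← mul_pow, hab]; norm_num) n
    have h₀ := sum_choose_mul_pow_add_pow (x := (1 : ℝ)) (y := 1) (one_mul 1) n
    rw [show a ^ 4 + b ^ 4 + 2 = 3 ^ 2 by linear_combination hs₄, ← pow_mul] at h₄
    rw [show -a ^ 2 + -b ^ 2 + 2 = -1 by linear_combination -hs₂] at h₂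
    rw [show (1 : ℝ) + 1 + 2 = 2 ^ 2 by norm_num, ← pow_mul] at h₀
    have hterm (k : ℕ) : (lucas k : ℝ) ^ 4 = ((a ^ 4) ^ k + (b ^ 4) ^ k) +
        4 * ((-a ^ 2) ^ k + (-b ^ 2) ^ k) + 3 * (1 ^ k + 1 ^ k) := by
      have hk : a ^ k * b ^ k = (-1) ^ k := by rw [← mul_pow, hab]
      have hsq : ((-1 : ℝ) ^ k) ^ 2 = 1 := by rw [← pow_mul, mul_comm, pow_mul]; norm_num
      rw [hL, neg_pow (a ^ 2), neg_pow (b ^ 2), one_pow, pow_right_comm a,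
        pow_right_comm b, pow_right_comm a, pow_right_comm b]
      linear_combination (4 * ((a ^ k) ^ 2 + (b ^ k) ^ 2) +
        6 * (a ^ k * b ^ k + (-1) ^ k)) * hk + 6 * hsq
    rw [Finset.sum_congr rfl fun k _ => show _ =
        (Nat.choose (2 * n) (n + k) : ℝ) * ((a ^ 4) ^ k + (b ^ 4) ^ k) +
        4 * ((Nat.choose (2 * n) (n + k) : ℝ) * ((-a ^ 2) ^ k + (-b ^ 2) ^ k)) +
        3 * ((Nat.choose (2 * n) (n + k) : ℝ) * (1 ^ k + 1 ^ k)) by rw [hterm]; ring,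
      Finset.sum_add_distrib, Finset.sum_add_distrib, ← Finset.mul_sum, ← Finset.mul_sum,
      h₄, h₂, h₀]
    ring
  exact_mod_cast key
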